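/- arXiv:1708.08420 — 2 statements merged into one kernel-verified Lean document; each statement's English description precedes it below -/
import Mathlib

section
/- Let d ≥ 2 be an integer and let t_1, t_2 be rational numbers with t_1 ≥ 0 and t_2 ≥ 0. There exists a (t_1,t_2)-semistable triple (f, l_1, l_2), where f is a nonzero homogeneous polynomial of degree d in ℂ[x_0,x_1,x_2] and l_1, l_2 are nonzero linear forms, if and only if 2t_1 − t_2 ≤ d and 2t_2 − t_1 ≤ d. -/
open MvPolynomial

/-- The Hilbert–Mumford function `μ(f, r)`: the minimum over all monomials
`x_0^{d_0} ⋯ x_{m-1}^{d_{m-1}}` occurring in `f` of `∑ i, d_i * r_i`.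
(Junk value `0` if the support is empty.) -/
noncomputable def mu {m : ℕ} (f : MvPolynomial (Fin m) ℂ) (r : Fin m → ℤ) : ℤ :=
  if h : f.support.Nonempty then
    f.support.inf' h (fun D => ∑ i, (D i : ℤ) * r i)
  else 0

/-- A weight vector `r` is normalized if `r ≠ 0`, `r_0 ≥ r_1 ≥ ⋯ ≥ r_{m-1}` and `∑ r_i = 0`. -/
def Normalized {m : ℕ} (r : Fin m → ℤ) : Prop :=
  r ≠ 0 ∧ (∀ i j : Fin m, i ≤ j → r j ≤ r i) ∧ ∑ i, r i = 0

/-- The action of a matrix on polynomials by linear substitution of the variables. -/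
noncomputable def act {m : ℕ} (g : Matrix (Fin m) (Fin m) ℂ)
    (f : MvPolynomial (Fin m) ℂ) : MvPolynomial (Fin m) ℂ :=
  aeval (fun i => ∑ j, C (g i j) * X j) f

/-- `(f, l)` is `t`-semistable if `μ(g·f, r) + ∑ i, t i · μ(g·l_i, r) ≤ 0` for every
`g ∈ SL(m, ℂ)` and every normalized weight vector `r`. -/
def SemiStable {m : ℕ} {ι : Type} [Fintype ι] (t : ι → ℚ)
    (f : MvPolynomial (Fin m) ℂ) (l : ι → MvPolynomial (Fin m) ℂ) : Prop :=
  ∀ g : Matrix.SpecialLinearGroup (Fin m) ℂ, ∀ r : Fin m → ℤ, Normalized r →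
    (mu (act (g : Matrix (Fin m) (Fin m) ℂ) f) r : ℚ)
      + ∑ i, t i * (mu (act (g : Matrix (Fin m) (Fin m) ℂ) (l i)) r : ℚ) ≤ 0

/-- `(f, l)` is `t`-stable if the strict inequality holds for all `g` and normalized `r`. -/
def Stable {m : ℕ} {ι : Type} [Fintype ι] (t : ι → ℚ)
    (f : MvPolynomial (Fin m) ℂ) (l : ι → MvPolynomial (Fin m) ℂ) : Prop :=
  ∀ g : Matrix.SpecialLinearGroup (Fin m) ℂ, ∀ r : Fin m → ℤ, Normalized r →
    (mu (act (g : Matrix (Fin m) (Fin m) ℂ) f) r : ℚ)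
      + ∑ i, t i * (mu (act (g : Matrix (Fin m) (Fin m) ℂ) (l i)) r : ℚ) < 0


lemma mu_le_of_coeff {m : ℕ} (f : MvPolynomial (Fin m) ℂ) (r : Fin m → ℤ) (D : Fin m →₀ ℕ)
    (h : coeff D f ≠ 0) : mu f r ≤ ∑ i, (D i : ℤ) * r i := by
  have hD : D ∈ f.support := by simpa [MvPolynomial.mem_support_iff] using h
  unfold mu
  rw [dif_pos ⟨D, hD⟩]
  exact Finset.inf'_le (fun D : Fin m →₀ ℕ => ∑ i, (D i : ℤ) * r i) hD

lemma exists_mu {m : ℕ} (f : MvPolynomial (Fin m) ℂ) (r : Fin m → ℤ) (h : f ≠ 0) :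
    ∃ D : Fin m →₀ ℕ, coeff D f ≠ 0 ∧ mu f r = ∑ i, (D i : ℤ) * r i := by
  have hs : f.support.Nonempty := by simpa [MvPolynomial.support_nonempty] using h
  unfold mu
  rw [dif_pos hs]
  obtain ⟨D, hD, e⟩ := Finset.exists_mem_eq_inf' hs (fun D : Fin m →₀ ℕ => ∑ i, (D i : ℤ) * r i)
  exact ⟨D, by simpa [MvPolynomial.mem_support_iff] using hD, e⟩

lemma act_homog {m n : ℕ} (g : Matrix (Fin m) (Fin m) ℂ) (f : MvPolynomial (Fin m) ℂ)
    (hf : f.IsHomogeneous n) : (act g f).IsHomogeneous n := by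
  unfold act
  have := hf.aeval (n := 1) (fun i => ∑ j, C (g i j) * X j) (by
    intro i
    apply IsHomogeneous.sum
    intro j _
    exact isHomogeneous_C_mul_X _ _)
  simpa using this

/-- tag each variable with a power of an auxiliary variable -/
noncomputable def tagHom {m : ℕ} (w : Fin m → ℕ) :
    MvPolynomial (Fin m) ℂ →ₐ[ℂ] Polynomial (MvPolynomial (Fin m) ℂ) :=
  aeval (fun i => Polynomial.C (X i) * Polynomial.X ^ (w i))

lemma tagHom_monomial {m : ℕ} (w : Fin m → ℕ) (D : Fin m →₀ ℕ) (c : ℂ) :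
    tagHom w (monomial D c) =
      Polynomial.C (monomial D c) * Polynomial.X ^ (∑ i, D i * w i) := by
  unfold tagHom
  rw [aeval_monomial, Finsupp.prod_fintype _ _ (by simp)]
  simp_rw [mul_pow, Finset.prod_mul_distrib, ← pow_mul]
  rw [Finset.prod_pow_eq_pow_sum, monomial_eq, Finsupp.prod_fintype _ _ (by simp)]
  simp only [map_mul, map_prod, map_pow, ← mul_assoc]
  simp only [mul_comm (w _)]
  rfl

lemma coeff_tagHom {m : ℕ} (w : Fin m → ℕ) (f : MvPolynomial (Fin m) ℂ) (N : ℕ)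
    (D : Fin m →₀ ℕ) :
    coeff D ((tagHom w f).coeff N) = if ∑ i, D i * w i = N then coeff D f else 0 := by
  induction f using MvPolynomial.induction_on' with
  | monomial E c =>
    rw [tagHom_monomial, Polynomial.coeff_C_mul_X_pow]
    by_cases hE : E = D
    · subst hE; simp [eq_comm]
      split_ifs <;> simp
    · split_ifs <;> simp [hE]
  | add p q hp hq =>
    simp only [map_add, Polynomial.coeff_add, coeff_add, hp, hq]
    split_ifs <;> simp

lemma mu_mul_le {m n n' : ℕ} (f g : MvPolynomial (Fin m) ℂ) (hf : f.IsHomogeneous n)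
    (hg : g.IsHomogeneous n') (hf0 : f ≠ 0) (hg0 : g ≠ 0) (r : Fin m → ℤ) (b : ℤ)
    (hb : ∀ i, b ≤ r i) : mu (f * g) r ≤ mu f r + mu g r := by
  obtain ⟨D, hD, eD⟩ := exists_mu f r hf0
  obtain ⟨E, hE, eE⟩ := exists_mu g r hg0
  set w : Fin m → ℕ := fun i => (r i - b).toNat with hw
  have hwi : ∀ i, (w i : ℤ) = r i - b := fun i => Int.toNat_of_nonneg (by have := hb i; omega)
  have conv : ∀ (F : Fin m →₀ ℕ), ∑ i, (F i : ℤ) * r i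
      = ((∑ i, F i * w i : ℕ) : ℤ) + b * ((∑ i, F i : ℕ) : ℤ) := by
    intro F
    push_cast
    rw [Finset.mul_sum, ← Finset.sum_add_distrib]
    refine Finset.sum_congr rfl fun i _ => ?_
    rw [hwi]; ring
  have hdeg : ∀ {k : ℕ} {p : MvPolynomial (Fin m) ℂ} (_ : p.IsHomogeneous k) {F : Fin m →₀ ℕ},
      coeff F p ≠ 0 → ∑ i, F i = k := by
    intro k p hp F hF
    have := hp hF
    simpa [Finsupp.weight_apply, Finsupp.sum_fintype] using this
  have key : ∀ (p : MvPolynomial (Fin m) ℂ) (F : Fin m →₀ ℕ), coeff F p ≠ 0 →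
      (tagHom w p).coeff (∑ i, F i * w i) ≠ 0 := by
    intro p F hF h0
    have := coeff_tagHom w p (∑ i, F i * w i) F
    rw [h0] at this
    simp at this
    exact hF this.symm
  have hA := key f D hD
  have hB := key g E hE
  have hA' := Polynomial.natTrailingDegree_le_of_ne_zero hA
  have hB' := Polynomial.natTrailingDegree_le_of_ne_zero hB
  have hA0 : tagHom w f ≠ 0 := by rintro h; simp [h] at hA
  have hB0 : tagHom w g ≠ 0 := by rintro h; simp [h] at hB
  have hmul := Polynomial.natTrailingDegree_mul hA0 hB0
  have hne : (tagHom w (f * g)).coeff (tagHom w (f * g)).natTrailingDegree ≠ 0 := by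
    have : tagHom w (f * g) ≠ 0 := by rw [map_mul]; exact mul_ne_zero hA0 hB0
    exact Polynomial.trailingCoeff_nonzero_iff_nonzero.mpr this
  obtain ⟨F, hF⟩ := MvPolynomial.ne_zero_iff.mp hne
  rw [coeff_tagHom] at hF
  split_ifs at hF with hFN
  · have h1 := mu_le_of_coeff (f * g) r F hF
    rw [conv] at h1 eD eE
    rw [hdeg (hf.mul hg) hF] at h1
    rw [hdeg hf hD] at eD
    rw [hdeg hg hE] at eE
    rw [map_mul, hmul] at hFN
    have : (∑ i, F i * w i) ≤ (∑ i, D i * w i) + ∑ i, E i * w i := by omega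
    have h3 : ((∑ i, F i * w i : ℕ) : ℤ) ≤ ((∑ i, D i * w i : ℕ) : ℤ) + ((∑ i, E i * w i : ℕ) : ℤ) := by
      exact_mod_cast this
    rw [eD, eE]
    push_cast at h1 h3 ⊢
    linarith
  · exact absurd rfl hF

lemma mu_prod_le {m : ℕ} (s : Finset ℕ) (L : ℕ → MvPolynomial (Fin m) ℂ)
    (hL : ∀ i, (L i).IsHomogeneous 1) (hL0 : ∀ i, L i ≠ 0) (r : Fin m → ℤ) (b : ℤ)
    (hb : ∀ i, b ≤ r i) : mu (∏ i ∈ s, L i) r ≤ ∑ i ∈ s, mu (L i) r := by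
  induction s using Finset.induction_on with
  | empty =>
    have := mu_le_of_coeff (1 : MvPolynomial (Fin m) ℂ) r 0 (by simp)
    simpa using this
  | insert a s ha ih =>
    rw [Finset.prod_insert ha, Finset.sum_insert ha]
    have := mu_mul_le (L a) (∏ i ∈ s, L i) (hL a)
      (IsHomogeneous.prod s L (fun _ => 1) (fun i _ => hL i)) (hL0 a)
      (Finset.prod_ne_zero_iff.mpr fun i _ => hL0 i) r b hb
    linarith

/-- linear form with given coefficients -/
noncomputable def lin (c : Fin 3 → ℂ) : MvPolynomial (Fin 3) ℂ := ∑ j, C (c j) * X j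

lemma lin_homog (c : Fin 3 → ℂ) : (lin c).IsHomogeneous 1 :=
  IsHomogeneous.sum _ _ _ fun j _ => isHomogeneous_C_mul_X _ _

lemma coeff_lin (c : Fin 3 → ℂ) (j : Fin 3) : coeff (Finsupp.single j 1) (lin c) = c j := by
  unfold lin
  simp [coeff_sum, coeff_C_mul, coeff_X, Finsupp.single_left_inj]

lemma mu_lin_le (c : Fin 3 → ℂ) (r : Fin 3 → ℤ) (j : Fin 3) (h : c j ≠ 0) :
    mu (lin c) r ≤ r j := by
  have := mu_le_of_coeff (lin c) r (Finsupp.single j 1) (by rwa [coeff_lin])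
  simpa [Finsupp.single_apply] using this

lemma act_lin (g : Matrix (Fin 3) (Fin 3) ℂ) (c : Fin 3 → ℂ) :
    act g (lin c) = lin (fun j => ∑ i, c i * g i j) := by
  simp only [act, lin, Fin.sum_univ_three, map_add, map_mul, aeval_X, algHom_C, algebraMap_eq]
  ring

lemma degree_one {D : Fin 3 →₀ ℕ} (h : D.degree = 1) : ∃ j, D = Finsupp.single j 1 := by
  have h3 : D 0 + D 1 + D 2 = 1 := by
    simpa [Finsupp.degree_eq_sum, Fin.sum_univ_three] using h
  have : D 0 = 1 ∧ D 1 = 0 ∧ D 2 = 0 ∨ D 0 = 0 ∧ D 1 = 1 ∧ D 2 = 0 ∨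
    D 0 = 0 ∧ D 1 = 0 ∧ D 2 = 1 := by omega
  rcases this with ⟨a, b, c⟩ | ⟨a, b, c⟩ | ⟨a, b, c⟩
  · exact ⟨0, by ext i; fin_cases i <;> simp [a, b, c]⟩
  · exact ⟨1, by ext i; fin_cases i <;> simp [a, b, c]⟩
  · exact ⟨2, by ext i; fin_cases i <;> simp [a, b, c]⟩

lemma eq_lin (l : MvPolynomial (Fin 3) ℂ) (h : l.IsHomogeneous 1) :
    l = lin (fun j => coeff (Finsupp.single j 1) l) := by
  ext D
  by_cases hD : D.degree = 1
  · obtain ⟨j, rfl⟩ : ∃ j, D = Finsupp.single j 1 := by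
      exact degree_one hD
    rw [coeff_lin]
  · rw [h.coeff_eq_zero hD, (lin_homog _).coeff_eq_zero hD]

lemma exists_g (a : Fin 3 → ℂ) (ha : a ≠ 0) : ∃ g : Matrix.SpecialLinearGroup (Fin 3) ℂ,
    ∑ i, a i * g.1 i 0 ≠ 0 ∧ ∑ i, a i * g.1 i 1 = 0 ∧ ∑ i, a i * g.1 i 2 = 0 := by
  by_cases h0 : a 0 = 0
  · by_cases h1 : a 1 = 0
    · have h2 : a 2 ≠ 0 := by
        intro h2; apply ha; ext i; fin_cases i <;> simp [h0, h1, h2]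
      refine ⟨⟨!![0, 1, 0; 0, 0, 1; 1, 0, 0], ?_⟩, ?_⟩
      · simp [Matrix.det_fin_three]
      · simp [Fin.sum_univ_three, h0, h1, h2]
    · refine ⟨⟨!![0, -1, 0; 1, 0, -(a 2 / a 1); 0, 0, 1], ?_⟩, ?_⟩
      · simp [Matrix.det_fin_three]
      · simp [Fin.sum_univ_three, h0, h1]
        field_simp; ring
  · refine ⟨⟨!![1, -(a 1 / a 0), -(a 2 / a 0); 0, 1, 0; 0, 0, 1], ?_⟩, ?_⟩
    · simp [Matrix.det_fin_three]
    · simp [Fin.sum_univ_three, h0]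
      constructor <;> field_simp <;> ring

lemma mu_ge (n : ℕ) (f : MvPolynomial (Fin 3) ℂ) (hf : f.IsHomogeneous n) :
    -(n : ℤ) ≤ mu f ![2, -1, -1] := by
  by_cases h : f = 0
  · subst h; simp [mu]
  · obtain ⟨D, hD, e⟩ := exists_mu f ![2, -1, -1] h
    have := hf hD
    simp [Finsupp.weight_apply, Finsupp.sum_fintype, Fin.sum_univ_three] at this
    rw [e]
    simp [Fin.sum_univ_three]
    omega

lemma necessity (d : ℕ) (t₁ t₂ : ℚ) (ht₁ : 0 ≤ t₁) (ht₂ : 0 ≤ t₂)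
    (f l₁ l₂ : MvPolynomial (Fin 3) ℂ) (hf : f.IsHomogeneous d) (h0 : l₁ ≠ 0)
    (h1 : l₁.IsHomogeneous 1) (h2 : l₂.IsHomogeneous 1)
    (H : ∀ g : Matrix.SpecialLinearGroup (Fin 3) ℂ, ∀ r : Fin 3 → ℤ, Normalized r →
      (mu (act g.1 f) r : ℚ) + (t₁ * (mu (act g.1 l₁) r : ℚ) + t₂ * (mu (act g.1 l₂) r : ℚ)) ≤ 0) :
    2 * t₁ - t₂ ≤ (d : ℚ) := by
  have e := eq_lin l₁ h1
  set a : Fin 3 → ℂ := fun j => coeff (Finsupp.single j 1) l₁ with ha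
  have ha0 : a ≠ 0 := by
    intro h; apply h0; rw [e, h]; simp [lin]
  obtain ⟨g, g0, g1, g2⟩ := exists_g a ha0
  have hr : Normalized (![2, -1, -1] : Fin 3 → ℤ) := by
    refine ⟨fun h => by simpa using congrFun h 0, by decide, by decide⟩
  have := H g _ hr
  have b1 := mu_ge d _ (act_homog g.1 f hf)
  have b2 := mu_ge 1 _ (act_homog g.1 l₂ h2)
  have b3 : 2 ≤ mu (act g.1 l₁) ![2, -1, -1] := by
    rw [e, act_lin]
    have hne : lin (fun j => ∑ i, a i * g.1 i j) ≠ 0 := by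
      intro h
      have := coeff_lin (fun j => ∑ i, a i * g.1 i j) 0
      rw [h] at this
      exact g0 this.symm
    obtain ⟨D, hD, eD⟩ := exists_mu _ ![2, -1, -1] hne
    have hdeg : D.degree = 1 := by
      by_contra h
      exact hD ((lin_homog _).coeff_eq_zero h)
    obtain ⟨j, rfl⟩ : ∃ j, D = Finsupp.single j 1 := by
      exact degree_one hdeg
    rw [coeff_lin] at hD
    rw [eD]
    fin_cases j
    · simp [Finsupp.single_apply]
    · exact absurd g1 hD
    · exact absurd g2 hD
  have c1 : -(d : ℚ) ≤ (mu (act g.1 f) ![2, -1, -1] : ℚ) := by exact_mod_cast b1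
  have c2 : -(1 : ℚ) ≤ (mu (act g.1 l₂) ![2, -1, -1] : ℚ) := by exact_mod_cast b2
  have c3 : (2 : ℚ) ≤ (mu (act g.1 l₁) ![2, -1, -1] : ℚ) := by exact_mod_cast b3
  nlinarith [mul_le_mul_of_nonneg_left c2 ht₂, mul_le_mul_of_nonneg_left c3 ht₁]

/-- points on the moment curve -/
noncomputable def mom (s : ℕ) : Fin 3 → ℂ := ![1, (s : ℂ), (s : ℂ) ^ 2]

lemma mom_indep (g : Matrix.SpecialLinearGroup (Fin 3) ℂ) (a b e : ℕ) (hab : a ≠ b)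
    (hae : a ≠ e) (hbe : b ≠ e) (c : ℕ → Fin 3 → ℂ)
    (hc : c = fun s j => ∑ i, mom s i * g.1 i j) :
    c a 0 * (c b 1 * c e 2 - c b 2 * c e 1) - c a 1 * (c b 0 * c e 2 - c b 2 * c e 0)
      + c a 2 * (c b 0 * c e 1 - c b 1 * c e 0) ≠ 0 := by
  have hdet := g.2
  rw [Matrix.det_fin_three] at hdet
  have h1 : (b : ℂ) - a ≠ 0 := sub_ne_zero.mpr (by exact_mod_cast hab.symm)
  have h2 : (e : ℂ) - a ≠ 0 := sub_ne_zero.mpr (by exact_mod_cast hae.symm)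
  have h3 : (e : ℂ) - b ≠ 0 := sub_ne_zero.mpr (by exact_mod_cast hbe.symm)
  have key : c a 0 * (c b 1 * c e 2 - c b 2 * c e 1) - c a 1 * (c b 0 * c e 2 - c b 2 * c e 0)
      + c a 2 * (c b 0 * c e 1 - c b 1 * c e 0)
      = ((b : ℂ) - a) * ((e : ℂ) - a) * ((e : ℂ) - b) * 1 := by
    rw [← hdet, hc]
    simp [mom, Fin.sum_univ_three]
    ring
  rw [key]
  simp [h1, h2, h3]

/-- at most one index is very bad, at most one more is bad -/
lemma exists_bad (c : ℕ → Fin 3 → ℂ) (m : ℕ → ℤ) (r : Fin 3 → ℤ) (h10 : r 1 ≤ r 0)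
    (h21 : r 2 ≤ r 1)
    (H : ∀ a b e : ℕ, a ≠ b → a ≠ e → b ≠ e →
      c a 0 * (c b 1 * c e 2 - c b 2 * c e 1) - c a 1 * (c b 0 * c e 2 - c b 2 * c e 0)
      + c a 2 * (c b 0 * c e 1 - c b 1 * c e 0) ≠ 0)
    (hm : ∀ s j, c s j ≠ 0 → m s ≤ r j) :
    ∃ a b : ℕ, a ≠ b ∧ m a ≤ r 0 ∧ m b ≤ r 1 ∧ ∀ s, s ≠ a → s ≠ b → m s ≤ r 2 := by
  have all0 : ∀ s, m s ≤ r 0 := by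
    intro s
    by_contra hs
    have z : ∀ j, c s j = 0 := by
      intro j; by_contra hj
      have := hm s j hj
      fin_cases j <;> simp at this <;> omega
    refine H s (s + 1) (s + 2) (by omega) (by omega) (by omega) ?_
    simp [z]
  have two1 : ∀ a b, a ≠ b → ¬ (r 1 < m a ∧ r 1 < m b) := by
    rintro a b hab ⟨ha, hb⟩
    have za1 : c a 1 = 0 := by by_contra h; have := hm a 1 h; omega
    have za2 : c a 2 = 0 := by by_contra h; have := hm a 2 h; omega
    have zb1 : c b 1 = 0 := by by_contra h; have := hm b 1 h; omega
    have zb2 : c b 2 = 0 := by by_contra h; have := hm b 2 h; omega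
    refine H a b (a + b + 1) hab (by omega) (by omega) ?_
    simp [za1, za2, zb1, zb2]
  have three2 : ∀ a b e, a ≠ b → a ≠ e → b ≠ e → ¬ (r 2 < m a ∧ r 2 < m b ∧ r 2 < m e) := by
    rintro a b e hab hae hbe ⟨ha, hb, he⟩
    have za2 : c a 2 = 0 := by by_contra h; have := hm a 2 h; omega
    have zb2 : c b 2 = 0 := by by_contra h; have := hm b 2 h; omega
    have ze2 : c e 2 = 0 := by by_contra h; have := hm e 2 h; omega
    refine H a b e hab hae hbe ?_
    simp [za2, zb2, ze2]
  -- choose a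
  obtain ⟨a, ha⟩ : ∃ a, (∀ s, s ≠ a → m s ≤ r 1) ∧ (r 2 < m a ∨ ∀ s, m s ≤ r 2) := by
    by_cases h : ∃ a, r 1 < m a
    · obtain ⟨a, ha⟩ := h
      refine ⟨a, fun s hs => ?_, Or.inl (by omega)⟩
      have := two1 s a hs
      omega
    · push Not at h
      by_cases h' : ∃ a, r 2 < m a
      · obtain ⟨a, ha⟩ := h'
        exact ⟨a, fun s _ => h s, Or.inl ha⟩
      · push Not at h'
        exact ⟨0, fun s _ => h s, Or.inr h'⟩
  obtain ⟨ha1, ha2⟩ := ha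
  by_cases h : ∃ b, b ≠ a ∧ r 2 < m b
  · obtain ⟨b, hba, hb⟩ := h
    refine ⟨a, b, hba.symm, all0 a, ha1 b hba, fun s hsa hsb => ?_⟩
    rcases ha2 with ha2 | ha2
    · have := three2 s a b hsa hsb hba.symm
      omega
    · exact ha2 s
  · push Not at h
    exact ⟨a, a + 1, by omega, all0 a, ha1 _ (by omega), fun s hs _ => h s hs⟩

lemma weighted_sum_le (n : ℕ) (w : ℕ → ℚ) (m : ℕ → ℤ) (r : Fin 3 → ℤ) (h10 : r 1 ≤ r 0)
    (h21 : r 2 ≤ r 1) (hr : r 0 + r 1 + r 2 = 0) (hw : ∀ s, 0 ≤ w s)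
    (hW : ∀ s, 3 * w s ≤ ∑ i ∈ Finset.range n, w i) (a b : ℕ) (hab : a ≠ b) (ha : m a ≤ r 0)
    (hb : m b ≤ r 1) (hs : ∀ s, s ≠ a → s ≠ b → m s ≤ r 2) :
    ∑ i ∈ Finset.range n, w i * (m i : ℚ) ≤ 0 := by
  have q10 : (r 1 : ℚ) ≤ r 0 := by exact_mod_cast h10
  have q21 : (r 2 : ℚ) ≤ r 1 := by exact_mod_cast h21
  have qr : (r 0 : ℚ) + r 1 + r 2 = 0 := by exact_mod_cast hr
  have step : ∀ i ∈ Finset.range n, w i * (m i : ℚ) ≤ w i * (r 2 : ℚ)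
      + ((if i = a then w a * ((r 0 : ℚ) - r 2) else 0)
        + (if i = b then w b * ((r 1 : ℚ) - r 2) else 0)) := by
    intro i _
    by_cases hia : i = a
    · subst hia
      have : (m i : ℚ) ≤ r 0 := by exact_mod_cast ha
      simp [hab]
      nlinarith [hw i]
    · by_cases hib : i = b
      · subst hib
        have : (m i : ℚ) ≤ r 1 := by exact_mod_cast hb
        simp [hia]
        nlinarith [hw i]
      · have : (m i : ℚ) ≤ r 2 := by exact_mod_cast hs i hia hib
        simp [hia, hib]
        nlinarith [hw i]
  refine (Finset.sum_le_sum step).trans ?_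
  rw [Finset.sum_add_distrib, Finset.sum_add_distrib, ← Finset.sum_mul, Finset.sum_ite_eq',
    Finset.sum_ite_eq']
  set W := ∑ i ∈ Finset.range n, w i
  have e1 : (if a ∈ Finset.range n then w a * ((r 0 : ℚ) - r 2) else 0)
      ≤ w a * ((r 0 : ℚ) - r 2) := by
    split_ifs
    · exact le_refl _
    · exact mul_nonneg (hw a) (by linarith)
  have e2 : (if b ∈ Finset.range n then w b * ((r 1 : ℚ) - r 2) else 0)
      ≤ w b * ((r 1 : ℚ) - r 2) := by
    split_ifs
    · exact le_refl _
    · exact mul_nonneg (hw b) (by linarith)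
  have e3 := mul_le_mul_of_nonneg_right (hW a) (show (0 : ℚ) ≤ (r 0 : ℚ) - r 2 by linarith)
  have e4 := mul_le_mul_of_nonneg_right (hW b) (show (0 : ℚ) ≤ (r 1 : ℚ) - r 2 by linarith)
  have e5 : W * ((r 0 : ℚ) - r 2) + W * ((r 1 : ℚ) - r 2) + 3 * (W * r 2) = 0 := by
    linear_combination W * qr
  linarith

lemma mom_semistable (d : ℕ) (t₁ t₂ : ℚ) (ht₁ : 0 ≤ t₁) (ht₂ : 0 ≤ t₂)
    (h3 : 3 ≤ (d : ℚ) + t₁ + t₂) (h1 : 2 * t₁ - t₂ ≤ d) (h2 : 2 * t₂ - t₁ ≤ d)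
    (g : Matrix.SpecialLinearGroup (Fin 3) ℂ) (r : Fin 3 → ℤ) (hr : Normalized r) :
    (mu (act g.1 (∏ s ∈ Finset.range d, lin (mom s))) r : ℚ)
      + (t₁ * (mu (act g.1 (lin (mom d))) r : ℚ)
        + t₂ * (mu (act g.1 (lin (mom (d + 1)))) r : ℚ)) ≤ 0 := by
  obtain ⟨-, hmono, hsum⟩ := hr
  have h10 : r 1 ≤ r 0 := hmono 0 1 (by decide)
  have h21 : r 2 ≤ r 1 := hmono 1 2 (by decide)
  rw [Fin.sum_univ_three] at hsum
  set c : ℕ → Fin 3 → ℂ := fun s j => ∑ i, mom s i * g.1 i j with hc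
  have hact : ∀ s, act g.1 (lin (mom s)) = lin (c s) := fun s => act_lin _ _
  set m : ℕ → ℤ := fun s => mu (lin (c s)) r with hm
  have H := fun a b e hab hae hbe => mom_indep g a b e hab hae hbe c hc
  have hne : ∀ s, lin (c s) ≠ 0 := by
    intro s h
    have z : ∀ j, c s j = 0 := fun j => by rw [← coeff_lin (c s) j, h]; simp
    refine H s (s + 1) (s + 2) (by omega) (by omega) (by omega) ?_
    simp [z]
  obtain ⟨a, b, hab, ha, hb, hs⟩ := exists_bad c m r h10 h21 H
    (fun s j h => mu_lin_le (c s) r j h)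
  set w : ℕ → ℚ := fun s => if s < d then 1 else if s = d then t₁ else t₂ with hwdef
  have hw1 : ∀ s ∈ Finset.range d, w s = 1 := by
    intro s hs; simp [hwdef, Finset.mem_range.mp hs]
  have hwd : w d = t₁ := by simp [hwdef]
  have hwd1 : w (d + 1) = t₂ := by simp [hwdef]
  have hW : ∑ i ∈ Finset.range (d + 2), w i = d + t₁ + t₂ := by
    rw [Finset.sum_range_succ, Finset.sum_range_succ, Finset.sum_congr rfl hw1, hwd, hwd1]
    simp
  have fin := weighted_sum_le (d + 2) w m r h10 h21 hsum
    (by intro s; simp only [hwdef]; split_ifs <;> linarith)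
    (by intro s; rw [hW]; simp only [hwdef]; split_ifs <;> linarith) a b hab ha hb hs
  rw [Finset.sum_range_succ, Finset.sum_range_succ, hwd, hwd1,
    Finset.sum_congr rfl (fun s hs => by rw [hw1 s hs, one_mul])] at fin
  have hprod : act g.1 (∏ s ∈ Finset.range d, lin (mom s)) = ∏ s ∈ Finset.range d, lin (c s) := by
    rw [← Finset.prod_congr rfl (fun s _ => hact s)]
    simp only [act, map_prod]
  have hle := mu_prod_le (Finset.range d) (fun s => lin (c s)) (fun s => lin_homog _) hne r (r 2)
    (by intro i; exact hmono i 2 (Fin.le_last i))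
  have hle' : (mu (∏ s ∈ Finset.range d, lin (c s)) r : ℚ)
      ≤ ∑ s ∈ Finset.range d, (m s : ℚ) := by exact_mod_cast hle
  rw [hprod, hact, hact]
  linarith

/-- the conic -/
noncomputable def conic : MvPolynomial (Fin 3) ℂ := X 1 * X 2 + X 0 * X 0

lemma conic_homog : conic.IsHomogeneous 2 :=
  ((isHomogeneous_X _ _).mul (isHomogeneous_X _ _)).add
    ((isHomogeneous_X _ _).mul (isHomogeneous_X _ _))

lemma coeff_lin_mul (a b : Fin 3 → ℂ) (i j : Fin 3) :
    coeff (Finsupp.single i 1 + Finsupp.single j 1) (lin a * lin b) =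
      if i = j then a i * b i else a i * b j + a j * b i := by
  have e : lin a * lin b = ∑ k, ∑ l, monomial (Finsupp.single k 1 + Finsupp.single l 1)
      (a k * b l) := by
    unfold lin
    rw [Finset.sum_mul_sum]
    refine Finset.sum_congr rfl fun k _ => Finset.sum_congr rfl fun l _ => ?_
    rw [C_mul_X_eq_monomial, C_mul_X_eq_monomial, monomial_mul]
  rw [e]
  simp only [Fin.sum_univ_three, coeff_add, coeff_monomial]
  fin_cases i <;> fin_cases j <;>
    simp [Finsupp.ext_iff, Fin.forall_fin_succ, Finsupp.single_apply, add_comm]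
  all_goals ring

lemma conic_ne : conic ≠ 0 := by
  intro h
  have := congrArg (MvPolynomial.eval (fun _ => (1 : ℂ))) h
  simp [conic] at this

lemma conic_semistable (t₁ t₂ : ℚ) (ht₁ : 0 ≤ t₁) (ht₂ : 0 ≤ t₂) (h1 : t₁ + t₂ ≤ 1)
    (g : Matrix.SpecialLinearGroup (Fin 3) ℂ) (r : Fin 3 → ℤ) (hr : Normalized r) :
    (mu (act g.1 conic) r : ℚ)
      + (t₁ * (mu (act g.1 (X 0)) r : ℚ) + t₂ * (mu (act g.1 (X 0)) r : ℚ)) ≤ 0 := by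
  obtain ⟨-, hmono, hsum⟩ := hr
  have h10 : r 1 ≤ r 0 := hmono 0 1 (by decide)
  have h21 : r 2 ≤ r 1 := hmono 1 2 (by decide)
  rw [Fin.sum_univ_three] at hsum
  have hX : ∀ i, act g.1 (X i) = lin (g.1 i) := by intro i; simp [act, lin]
  have hq : act g.1 conic = lin (g.1 1) * lin (g.1 2) + lin (g.1 0) * lin (g.1 0) := by
    rw [← hX, ← hX, ← hX]; simp [act, conic]
  have hdet := g.2
  rw [Matrix.det_fin_three] at hdet
  set M := g.1
  set q := act M conic
  have hco : ∀ i j : Fin 3, coeff (Finsupp.single i 1 + Finsupp.single j 1) q ≠ 0 →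
      mu q r ≤ r i + r j := by
    intro i j h
    have := mu_le_of_coeff q r _ h
    simpa [add_mul, Finset.sum_add_distrib, Finsupp.single_apply] using this
  have c22 : r 2 + r 2 < mu q r → M 1 2 * M 2 2 + M 0 2 * M 0 2 = 0 := by
    intro h; by_contra h'
    have := hco 2 2 (by rw [hq, coeff_add, coeff_lin_mul, coeff_lin_mul]; simpa using h')
    omega
  have c12 : r 1 + r 2 < mu q r →
      M 1 1 * M 2 2 + M 1 2 * M 2 1 + (M 0 1 * M 0 2 + M 0 2 * M 0 1) = 0 := by
    intro h; by_contra h'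
    have := hco 1 2 (by rw [hq, coeff_add, coeff_lin_mul, coeff_lin_mul]; simpa using h')
    omega
  have c02 : r 0 + r 2 < mu q r →
      M 1 0 * M 2 2 + M 1 2 * M 2 0 + (M 0 0 * M 0 2 + M 0 2 * M 0 0) = 0 := by
    intro h; by_contra h'
    have := hco 0 2 (by rw [hq, coeff_add, coeff_lin_mul, coeff_lin_mul]; simpa using h')
    omega
  have c11 : r 1 + r 1 < mu q r → M 1 1 * M 2 1 + M 0 1 * M 0 1 = 0 := by
    intro h; by_contra h'
    have := hco 1 1 (by rw [hq, coeff_add, coeff_lin_mul, coeff_lin_mul]; simpa using h')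
    omega
  have hL : ∀ j, M 0 j ≠ 0 → mu (lin (M 0)) r ≤ r j := fun j h => mu_lin_le _ r j h
  set L := mu (lin (M 0)) r with hLdef
  -- the entries of the symmetric matrix of the conic, and its determinant
  set P00 := 2 * (M 1 0 * M 2 0 + M 0 0 * M 0 0) with hP00
  set P11 := 2 * (M 1 1 * M 2 1 + M 0 1 * M 0 1) with hP11
  set P22 := 2 * (M 1 2 * M 2 2 + M 0 2 * M 0 2) with hP22
  set P01 := M 1 0 * M 2 1 + M 1 1 * M 2 0 + (M 0 0 * M 0 1 + M 0 1 * M 0 0) with hP01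
  set P02 := M 1 0 * M 2 2 + M 1 2 * M 2 0 + (M 0 0 * M 0 2 + M 0 2 * M 0 0) with hP02
  set P12 := M 1 1 * M 2 2 + M 1 2 * M 2 1 + (M 0 1 * M 0 2 + M 0 2 * M 0 1) with hP12
  have disc : P02 * (P01 * P12 - P11 * P02) - P12 * (P00 * P12 - P01 * P02)
      + P22 * (P00 * P11 - P01 * P01) = -2 := by
    have : (-2 : ℂ) = -2 * 1 ^ 2 := by norm_num
    rw [this, ← hdet, hP00, hP11, hP22, hP01, hP02, hP12]
    ring
  have A : mu q r ≤ r 0 + r 2 := by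
    by_contra h
    have e1 := c22 (by omega)
    have e2 := c12 (by omega)
    have e3 := c02 (by omega)
    have e1' : P22 = 0 := by rw [hP22, e1, mul_zero]
    rw [e1', e2, e3] at disc
    norm_num at disc
  have B : mu q r ≤ 0 := by
    by_contra h
    have e1 := c22 (by omega)
    have e2 := c12 (by omega)
    by_cases hr1 : 0 ≤ r 1
    · omega
    · have e3 := c11 (by omega)
      have e1' : P22 = 0 := by rw [hP22, e1, mul_zero]
      have e3' : P11 = 0 := by rw [hP11, e3, mul_zero]
      rw [e1', e2, e3'] at disc
      norm_num at disc
  have D : mu q r + L ≤ 0 := by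
    by_cases h2 : M 0 2 = 0
    · by_cases h1 : M 0 1 = 0
      · have h0 : M 0 0 ≠ 0 := by intro h0; simp [h0, h1, h2] at hdet
        have := hL 0 h0
        by_contra h
        have e1 := c22 (by omega)
        have e2 := c12 (by omega)
        have e1' : P22 = 0 := by rw [hP22, e1, mul_zero]
        rw [h1, h2] at hP12 hdet
        have z : (M 1 1 * M 2 2 - M 1 2 * M 2 1) ^ 2 = 0 := by
          have u : M 1 1 * M 2 2 + M 1 2 * M 2 1 = 0 := by linear_combination e2 - hP12
          have v : M 1 2 * M 2 2 = 0 := by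
            rw [h2] at e1
            linear_combination e1
          linear_combination (M 1 1 * M 2 2 + M 1 2 * M 2 1) * u - 4 * M 1 1 * M 2 1 * v
        have z' := pow_eq_zero_iff (two_ne_zero) |>.mp z
        apply one_ne_zero (α := ℂ)
        rw [← hdet]
        linear_combination M 0 0 * z'
      · have := hL 1 h1
        omega
    · have := hL 2 h2
      omega
  have B' : (mu q r : ℚ) ≤ 0 := by exact_mod_cast B
  have D' : (mu q r : ℚ) + L ≤ 0 := by exact_mod_cast D
  rw [hX 0]
  have : (mu q r : ℚ) + (t₁ * (L : ℚ) + t₂ * (L : ℚ))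
      = (1 - (t₁ + t₂)) * (mu q r : ℚ) + (t₁ + t₂) * ((mu q r : ℚ) + L) := by ring
  show (mu q r : ℚ) + (t₁ * (L : ℚ) + t₂ * (L : ℚ)) ≤ 0
  rw [this]
  nlinarith [mul_nonneg (sub_nonneg.mpr h1) (neg_nonneg.mpr B'),
    mul_nonneg (add_nonneg ht₁ ht₂) (neg_nonneg.mpr D')]

/-- Lemma 2.8 of the paper: for `d ≥ 2` and `t_1, t_2 ≥ 0`, there exists a
`(t_1, t_2)`-semistable triple `(f, l_1, l_2)` with `f` a nonzero homogeneous
polynomial of degree `d` in three variables and `l_1, l_2` nonzero linear forms,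
if and only if `2t_1 − t_2 ≤ d` and `2t_2 − t_1 ≤ d`. -/
theorem stab_plane_curve_two_lines (d : ℕ) (hd : 2 ≤ d)
    (t₁ t₂ : ℚ) (ht₁ : 0 ≤ t₁) (ht₂ : 0 ≤ t₂) :
    (∃ f l₁ l₂ : MvPolynomial (Fin 3) ℂ,
        f ≠ 0 ∧ f.IsHomogeneous d ∧
        l₁ ≠ 0 ∧ l₁.IsHomogeneous 1 ∧
        l₂ ≠ 0 ∧ l₂.IsHomogeneous 1 ∧
        SemiStable ![t₁, t₂] f ![l₁, l₂]) ↔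
      (2 * t₁ - t₂ ≤ (d : ℚ) ∧ 2 * t₂ - t₁ ≤ (d : ℚ)) := by
  constructor
  · rintro ⟨f, l₁, l₂, -, hf, h10, h1, h20, h2, H⟩
    have H' : ∀ g : Matrix.SpecialLinearGroup (Fin 3) ℂ, ∀ r : Fin 3 → ℤ, Normalized r →
        (mu (act g.1 f) r : ℚ)
          + (t₁ * (mu (act g.1 l₁) r : ℚ) + t₂ * (mu (act g.1 l₂) r : ℚ)) ≤ 0 := by
      intro g r hr
      have := H g r hr
      rw [Fin.sum_univ_two] at this
      exact this
    refine ⟨necessity d t₁ t₂ ht₁ ht₂ f l₁ l₂ hf h10 h1 h2 H',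
      necessity d t₂ t₁ ht₂ ht₁ f l₂ l₁ hf h20 h2 h1 ?_⟩
    intro g r hr
    have := H' g r hr
    linarith
  · rintro ⟨h1, h2⟩
    by_cases h3 : 3 ≤ (d : ℚ) + t₁ + t₂
    · have hne : ∀ s, lin (mom s) ≠ 0 := by
        intro s h
        have := coeff_lin (mom s) 0
        rw [h] at this
        simp [mom] at this
      refine ⟨∏ s ∈ Finset.range d, lin (mom s), lin (mom d), lin (mom (d + 1)),
        Finset.prod_ne_zero_iff.mpr fun i _ => hne i, ?_, hne _, lin_homog _, hne _, lin_homog _,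
        ?_⟩
      · simpa using IsHomogeneous.prod (Finset.range d) (fun s => lin (mom s)) (fun _ => 1)
          (fun s _ => lin_homog _)
      · intro g r hr
        rw [Fin.sum_univ_two]
        exact mom_semistable d t₁ t₂ ht₁ ht₂ h3 h1 h2 g r hr
    · have hd2 : d = 2 := by
        by_contra hne
        have h3d : 3 ≤ d := by omega
        have : (3 : ℚ) ≤ d := by exact_mod_cast h3d
        linarith
      subst hd2
      refine ⟨conic, X 0, X 0, conic_ne, conic_homog, X_ne_zero _, isHomogeneous_X _ _,
        X_ne_zero _, isHomogeneous_X _ _, ?_⟩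
      intro g r hr
      rw [Fin.sum_univ_two]
      refine conic_semistable t₁ t₂ ht₁ ht₂ ?_ g r hr
      push_cast at h3
      linarith
end

section
/- There exists a 10×10 integer matrix P with det P = ±1 such that Pᵀ G_M P equals the block diagonal Gram matrix of U(2) ⊥ A_1 ⊥ A_1 ⊥ D_6; that is, the lattice M is isometric to U(2) ⊥ A_1² ⊥ D_6. -/
open Matrix

/-- The Gram matrix of the lattice `M = ℤ^10` with ordered basis
`(γ, l₁', α₁, α₂, α₃, l₂', β₁, β₂, β₃, ξ)`. -/
def G_M : Matrix (Fin 10) (Fin 10) ℤ :=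
  !![-2, 1, 0, 0, 0, 1, 0, 0, 0, 2;
     1, -2, 1, 1, 1, 0, 0, 0, 0, 0;
     0, 1, -2, 0, 0, 0, 0, 0, 0, 0;
     0, 1, 0, -2, 0, 0, 0, 0, 0, 0;
     0, 1, 0, 0, -2, 0, 0, 0, 0, 0;
     1, 0, 0, 0, 0, -2, 1, 1, 1, 0;
     0, 0, 0, 0, 0, 1, -2, 0, 0, 0;
     0, 0, 0, 0, 0, 1, 0, -2, 0, 0;
     0, 0, 0, 0, 0, 1, 0, 0, -2, 0;
     2, 0, 0, 0, 0, 0, 0, 0, 0, 0]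

/-- The block diagonal Gram matrix of `U(2) ⊥ A₁ ⊥ A₁ ⊥ D₆` (root lattices negative
definite; `D₆` is the negative of the Cartan matrix of type `D₆`). -/
def gramU2A1A1D6 : Matrix (Fin 10) (Fin 10) ℤ :=
  !![0, 2, 0, 0, 0, 0, 0, 0, 0, 0;
     2, 0, 0, 0, 0, 0, 0, 0, 0, 0;
     0, 0, -2, 0, 0, 0, 0, 0, 0, 0;
     0, 0, 0, -2, 0, 0, 0, 0, 0, 0;
     0, 0, 0, 0, -2, 1, 0, 0, 0, 0;
     0, 0, 0, 0, 1, -2, 1, 0, 0, 0;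
     0, 0, 0, 0, 0, 1, -2, 1, 0, 0;
     0, 0, 0, 0, 0, 0, 1, -2, 1, 1;
     0, 0, 0, 0, 0, 0, 0, 1, -2, 0;
     0, 0, 0, 0, 0, 0, 0, 1, 0, -2]

/-- The base change matrix. -/
def P_iso : Matrix (Fin 10) (Fin 10) ℤ :=
  !![4, 4, 5, 1, 0, 0, -1, 0, 0, 0;
     14, 14, 18, 2, 1, -1, -3, 0, 0, 0;
     8, 9, 11, 1, 0, 0, -2, 0, 0, 0;
     9, 8, 11, 1, 0, 0, -2, 0, 0, 0;
     7, 7, 9, 1, 0, -1, -1, 0, 0, 0;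
     6, 6, 8, 2, 0, 0, -2, 1, 0, 0;
     2, 2, 3, 1, 0, 0, 0, 0, 0, 0;
     3, 3, 4, 1, 0, 0, -1, 0, 1, 0;
     3, 3, 4, 1, 0, 0, -1, 0, 0, 1;
     0, 0, 0, -1, 0, 0, 0, 0, 0, 0]

/-- The inverse of `P_iso`. -/
def Q_iso : Matrix (Fin 10) (Fin 10) ℤ :=
  !![6, 0, -2, -1, 0, 0, 1, 0, 0, 4;
     6, 0, -1, -2, 0, 0, 1, 0, 0, 4;
     -8, 0, 2, 2, 0, 0, -1, 0, 0, -5;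
     0, 0, 0, 0, 0, 0, 0, 0, 0, -1;
     2, 1, -1, -1, -1, 0, 1, 0, 0, 2;
     5, 0, -1, -1, -1, 0, 2, 0, 0, 4;
     7, 0, -2, -2, 0, 0, 3, 0, 0, 6;
     6, 0, -2, -2, 0, 1, 2, 0, 0, 6;
     3, 0, -1, -1, 0, 0, 1, 1, 0, 3;
     3, 0, -1, -1, 0, 0, 1, 0, 1, 3]

/-- The first assertion of Proposition 3.7 of the paper: the lattice `M` is isometric
to `U(2) ⊥ A₁² ⊥ D₆`. -/
theorem M_isometric_U2A1A1D6 :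
    ∃ P : Matrix (Fin 10) (Fin 10) ℤ, (P.det = 1 ∨ P.det = -1) ∧
      Pᵀ * G_M * P = gramU2A1A1D6 := by
  refine ⟨P_iso, ?_, by decide +kernel⟩
  have h : P_iso * Q_iso = 1 := by decide +kernel
  have hd : P_iso.det * Q_iso.det = 1 := by rw [← Matrix.det_mul, h, Matrix.det_one]
  exact Int.isUnit_iff.mp (IsUnit.of_mul_eq_one _ hd)
end
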